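/- arXiv:1011.3169 — 5 statements merged into one kernel-verified Lean document; each statement's English description precedes it below -/
import Mathlib

section
/- Let p, q, a, b, λ, β, α, μ be real numbers with 1 < q < p, a > 0, b > 0, a + b = p − 1, λ > 0, α > 0, μ > 0 and 0 ≤ β·μ^b < α, and set M = (λ/(α − β·μ^b))^(1/(p-q)). Then for all real numbers w₁ ≥ 0, w₂ ≥ 0, s ∈ [0, M] and t ∈ [0, μ·M], one has λ·w₁·s^(q-1) + β·w₂·s^a·t^b ≤ α·M^(p-1)·max(w₁, w₂). -/
/-- Pointwise super-solution inequality from the proof of Theorem 2 of the paper: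
with `M = (λ/(α − βμ^b))^(1/(p-q))`, for `w₁, w₂ ≥ 0`, `s ∈ [0,M]`, `t ∈ [0,μM]`,
`λ w₁ s^(q-1) + β w₂ s^a t^b ≤ α M^(p-1) max(w₁, w₂)`. -/
theorem stmt_3 (p q a b lam beta alpha mu : ℝ)
    (hq : 1 < q) (hqp : q < p) (ha : 0 < a) (hb : 0 < b)
    (hab : a + b = p - 1) (hlam : 0 < lam) (halpha : 0 < alpha) (hmu : 0 < mu)
    (hbeta0 : 0 ≤ beta * mu ^ b) (hbeta : beta * mu ^ b < alpha)
    (M : ℝ) (hM : M = (lam / (alpha - beta * mu ^ b)) ^ ((1 : ℝ) / (p - q))) :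
    ∀ w₁ w₂ s t : ℝ, 0 ≤ w₁ → 0 ≤ w₂ → s ∈ Set.Icc 0 M → t ∈ Set.Icc 0 (mu * M) →
      lam * w₁ * s ^ (q - 1) + beta * w₂ * s ^ a * t ^ b ≤
        alpha * M ^ (p - 1) * max w₁ w₂ := by
  have hd : 0 < alpha - beta * mu ^ b := sub_pos.2 hbeta
  have hbeta' : 0 ≤ beta := nonneg_of_mul_nonneg_left hbeta0 (by positivity)
  have hM0 : 0 < M := hM ▸ by positivity
  have hMpow : M ^ (p - q) = lam / (alpha - beta * mu ^ b) := by
    rw [hM, one_div, Real.rpow_inv_rpow (by positivity) (sub_pos.2 hqp).ne']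
  have hlamM : lam * M ^ (q - 1) = (alpha - beta * mu ^ b) * M ^ (p - 1) := by
    rw [show p - 1 = (p - q) + (q - 1) by ring, Real.rpow_add hM0, hMpow]
    field_simp
  rintro w₁ w₂ s t hw₁ hw₂ ⟨hs0, hsM⟩ ⟨ht0, htM⟩
  calc lam * w₁ * s ^ (q - 1) + beta * w₂ * s ^ a * t ^ b
      ≤ lam * max w₁ w₂ * M ^ (q - 1) + beta * max w₁ w₂ * M ^ a * (mu * M) ^ b := by
        have hq' : 0 ≤ q - 1 := by linarith
        have hmax : 0 ≤ max w₁ w₂ := hw₁.trans (le_max_left _ _)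
        gcongr
        · exact le_max_left _ _
        · exact le_max_right _ _
    _ = lam * M ^ (q - 1) * max w₁ w₂ + beta * mu ^ b * M ^ (p - 1) * max w₁ w₂ := by
        rw [Real.mul_rpow hmu.le hM0.le, ← hab, Real.rpow_add hM0]
        ring
    _ = alpha * M ^ (p - 1) * max w₁ w₂ := by
        rw [hlamM]
        ring
end

section
/- Let p, q, a, b, λ, β, α, μ be real numbers with 1 < q < p, a > 0, b > 0, a + b < p − 1, λ > 0, β > 0, α > 0 and μ > 0. Then there exists a unique M > 0 such that α·M^(p-1) = λ·M^(q-1) + β·μ^b·M^(a+b); moreover this M satisfies α·M^(p-1) ≥ λ·M^(q-1). -/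
/-- A positive combination of two negative powers attains each positive value exactly once
on the positive half-line. -/
theorem existsUnique_pos_add_rpow_neg_eq {s t c d y : ℝ} (hs : 0 < s) (ht : 0 < t)
    (hc : 0 < c) (hd : 0 < d) (hy : 0 < y) :
    ∃! x : ℝ, 0 < x ∧ c * x ^ (-s) + d * x ^ (-t) = y := by
  have hanti : StrictAntiOn (fun x : ℝ => c * x ^ (-s) + d * x ^ (-t)) (Set.Ioi 0) := by
    intro u hu v _ huv
    have h1 := Real.rpow_lt_rpow_of_neg hu huv (neg_lt_zero.2 hs)
    have h2 := Real.rpow_lt_rpow_of_neg hu huv (neg_lt_zero.2 ht)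
    dsimp only
    gcongr
  have hcont : ContinuousOn (fun x : ℝ => c * x ^ (-s) + d * x ^ (-t)) (Set.Ioi 0) := by
    intro x hx
    have hx0 : x ≠ 0 := ne_of_gt hx
    exact (((Real.continuousAt_rpow_const x (-s) (Or.inl hx0)).const_mul c).add
      ((Real.continuousAt_rpow_const x (-t) (Or.inl hx0)).const_mul d)).continuousWithinAt
  have hlim : Filter.Tendsto (fun x : ℝ => c * x ^ (-s) + d * x ^ (-t)) Filter.atTop (nhds 0) := by
    simpa using ((tendsto_rpow_neg_atTop hs).const_mul c).add
      ((tendsto_rpow_neg_atTop ht).const_mul d)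
  obtain ⟨v, hvy, hv⟩ := ((hlim.eventually_lt_const hy).and (Filter.eventually_gt_atTop 0)).exists
  have hu : 0 < (y / c) ^ (-s)⁻¹ := Real.rpow_pos_of_pos (div_pos hy hc) _
  have huy : y ≤ c * ((y / c) ^ (-s)⁻¹) ^ (-s) + d * ((y / c) ^ (-s)⁻¹) ^ (-t) := by
    rw [Real.rpow_inv_rpow (div_pos hy hc).le (neg_ne_zero.2 hs.ne'), mul_div_cancel₀ _ hc.ne']
    exact le_add_of_nonneg_right (by positivity)
  obtain ⟨x, hx, hxy⟩ := isPreconnected_Ioi.intermediate_value (Set.mem_Ioi.2 hv)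
    (Set.mem_Ioi.2 hu) hcont ⟨hvy.le, huy⟩
  exact ⟨x, ⟨hx, hxy⟩, fun z hz => hanti.injOn hz.1 hx (hz.2.trans hxy.symm)⟩

/-- Corollary to Theorem 2 of the paper: if `a + b < p − 1`, there is a unique
`M > 0` with `α M^(p-1) = λ M^(q-1) + β μ^b M^(a+b)`, and this `M` satisfies
`α M^(p-1) ≥ λ M^(q-1)`. -/
theorem stmt_6 (p q a b lam beta alpha mu : ℝ)
    (hq : 1 < q) (hqp : q < p) (ha : 0 < a) (hb : 0 < b)
    (hab : a + b < p - 1) (hlam : 0 < lam) (hbeta : 0 < beta)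
    (halpha : 0 < alpha) (hmu : 0 < mu) :
    (∃! M : ℝ, 0 < M ∧
        alpha * M ^ (p - 1) = lam * M ^ (q - 1) + beta * mu ^ b * M ^ (a + b)) ∧
      ∀ M : ℝ, 0 < M →
        alpha * M ^ (p - 1) = lam * M ^ (q - 1) + beta * mu ^ b * M ^ (a + b) →
        alpha * M ^ (p - 1) ≥ lam * M ^ (q - 1) := by
  have hd : 0 < beta * mu ^ b := mul_pos hbeta (Real.rpow_pos_of_pos hmu b)
  refine ⟨?_, fun M hM h => h ▸ le_add_of_nonneg_right (by positivity)⟩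
  have key : ∀ M : ℝ, (0 < M ∧
      alpha * M ^ (p - 1) = lam * M ^ (q - 1) + beta * mu ^ b * M ^ (a + b)) ↔
      (0 < M ∧ lam * M ^ (-(p - q)) + beta * mu ^ b * M ^ (-(p - 1 - (a + b))) = alpha) := by
    refine fun M => and_congr_right fun hM => ?_
    have h1 : M ^ (q - 1) = M ^ (-(p - q)) * M ^ (p - 1) := by
      rw [← Real.rpow_add hM]; congr 1; ring
    have h2 : M ^ (a + b) = M ^ (-(p - 1 - (a + b))) * M ^ (p - 1) := by
      rw [← Real.rpow_add hM]; congr 1; ring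
    rw [h1, h2, ← mul_assoc, ← mul_assoc, ← add_mul,
      mul_left_inj' (Real.rpow_pos_of_pos hM _).ne', eq_comm]
  simp only [key]
  exact existsUnique_pos_add_rpow_neg_eq (sub_pos.2 hqp) (sub_pos.2 hab) hlam hd halpha
end

section
/- Let N ≥ 1, let Ω ⊆ ℝ^N be open, let p > 1 be real, let φ : ℝ^N → ℝ be differentiable, let ω : ℝ^N → ℝ, and let S, G, M > 0 be real. Define the classical p-Laplacian of a differentiable function w : ℝ^N → ℝ at x by Δ_p w(x) := div(‖∇w‖^{p-2}·∇w)(x), where the divergence is the trace of the Fréchet derivative at x of the vector field y ↦ ‖∇w(y)‖^{p-2}·∇w(y). Assume that for every x ∈ Ω: −Δ_p φ(x) = ω(x), 0 ≤ φ(x) ≤ S, and ‖∇φ(x)‖ ≤ G. Set α = S^{1-p} and μ = G/S, and let f : ℝ^N × ℝ × ℝ^N → ℝ satisfy f(x, u, v) ≤ α·ω(x)·M^{p-1} for all x ∈ Ω, u ∈ [0, M] and v with ‖v‖ ≤ μ·M. Then U := (M/S)·φ satisfies −Δ_p U(x) ≥ f(x, U(x), ∇U(x)) for every x ∈ Ω.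 -/
open Set

/-- The classical `p`-Laplacian of `w` at `x`: the divergence (trace of the
Fréchet derivative) of the vector field `y ↦ ‖∇w(y)‖^(p-2) • ∇w(y)`. -/
noncomputable def pLaplacian {N : ℕ} (p : ℝ)
    (w : EuclideanSpace ℝ (Fin N) → ℝ) (x : EuclideanSpace ℝ (Fin N)) : ℝ :=
  LinearMap.trace ℝ (EuclideanSpace ℝ (Fin N))
    (fderiv ℝ (fun y => ‖gradient w y‖ ^ (p - 2) • gradient w y) x).toLinearMap

/-- The gradient is homogeneous under scalar multiplication. -/
theorem gradient_const_mul_real {N : ℕ} (c : ℝ)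
    (w : EuclideanSpace ℝ (Fin N) → ℝ) (x : EuclideanSpace ℝ (Fin N)) :
    gradient (fun y => c * w y) x = c • gradient w x := by
  have h : fderiv ℝ (fun y => c * w y) x = c • fderiv ℝ w x :=
    congrFun (fderiv_const_smul_field (𝕜 := ℝ) c (f := w)) x
  simp [gradient, h]

/-- The `p`-Laplacian is positively homogeneous of degree `p - 1`. -/
theorem pLaplacian_const_mul {N : ℕ} (p : ℝ) {c : ℝ} (hc : 0 < c)
    (w : EuclideanSpace ℝ (Fin N) → ℝ) (x : EuclideanSpace ℝ (Fin N)) :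
    pLaplacian p (fun y => c * w y) x = c ^ (p - 1) * pLaplacian p w x := by
  have hfield : (fun y => ‖gradient (fun y => c * w y) y‖ ^ (p - 2) •
      gradient (fun y => c * w y) y) =
      c ^ (p - 1) • fun y => ‖gradient w y‖ ^ (p - 2) • gradient w y := by
    funext y
    have hpow : c ^ (p - 1) = c ^ (p - 2) * c := by
      rw [← Real.rpow_add_one hc.ne']
      ring_nf
    rw [gradient_const_mul_real, norm_smul, Real.norm_of_nonneg hc.le,
      Real.mul_rpow hc.le (norm_nonneg _), Pi.smul_apply, smul_smul, smul_smul, hpow]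
    ring_nf
  have hderiv := congrFun (fderiv_const_smul_field (𝕜 := ℝ) (c ^ (p - 1))
    (f := fun y => ‖gradient w y‖ ^ (p - 2) • gradient w y)) x
  rw [pLaplacian, hfield, hderiv]
  simp [pLaplacian]

/-- Proposition 1 of the paper (pointwise, classical version): under (H3),
`U = (M/S)·φ` is a super-solution of `−Δ_p u = f(x, u, ∇u)` on `Ω`. -/
theorem stmt_9 (N : ℕ) (hN : 1 ≤ N) (Ω : Set (EuclideanSpace ℝ (Fin N)))
    (hΩ : IsOpen Ω) (p : ℝ) (hp : 1 < p)
    (φ : EuclideanSpace ℝ (Fin N) → ℝ) (hφ : Differentiable ℝ φ)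
    (ω : EuclideanSpace ℝ (Fin N) → ℝ) (S G M : ℝ)
    (hS : 0 < S) (hG : 0 < G) (hM : 0 < M)
    (hφω : ∀ x ∈ Ω, -pLaplacian p φ x = ω x)
    (hφ0 : ∀ x ∈ Ω, 0 ≤ φ x) (hφS : ∀ x ∈ Ω, φ x ≤ S)
    (hφG : ∀ x ∈ Ω, ‖gradient φ x‖ ≤ G)
    (f : EuclideanSpace ℝ (Fin N) × ℝ × EuclideanSpace ℝ (Fin N) → ℝ)
    (hf : ∀ x ∈ Ω, ∀ u ∈ Set.Icc (0:ℝ) M, ∀ v : EuclideanSpace ℝ (Fin N),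
      ‖v‖ ≤ (G / S) * M → f (x, u, v) ≤ S ^ (1 - p) * ω x * M ^ (p - 1)) :
    ∀ x ∈ Ω,
      -pLaplacian p (fun y => (M / S) * φ y) x ≥
        f (x, (M / S) * φ x, gradient (fun y => (M / S) * φ y) x) := by
  intro x hx
  have hc : 0 < M / S := div_pos hM hS
  have hu : M / S * φ x ∈ Set.Icc (0 : ℝ) M := by
    refine ⟨mul_nonneg hc.le (hφ0 x hx), ?_⟩
    calc M / S * φ x ≤ M / S * S := mul_le_mul_of_nonneg_left (hφS x hx) hc.le
      _ = M := div_mul_cancel₀ M hS.ne'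
  have hv : ‖gradient (fun y => M / S * φ y) x‖ ≤ G / S * M := by
    rw [gradient_const_mul_real, norm_smul, Real.norm_of_nonneg hc.le]
    calc M / S * ‖gradient φ x‖ ≤ M / S * G := mul_le_mul_of_nonneg_left (hφG x hx) hc.le
      _ = G / S * M := by ring
  have hpow : (M / S) ^ (p - 1) = S ^ (1 - p) * M ^ (p - 1) := by
    rw [Real.div_rpow hM.le hS.le, ← neg_sub p 1, Real.rpow_neg hS.le]
    ring
  refine (hf x hx _ hu _ hv).trans_eq ?_
  rw [pLaplacian_const_mul p hc, hpow, ← hφω x hx]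
  ring
end

section
/- Let N ≥ 1, let Ω ⊆ ℝ^N be open, let p > 1 be real, let u₁ : ℝ^N → ℝ be differentiable, let ω : ℝ^N → ℝ, and let λ₁, G₁, ε₀, μ, M > 0 be real. Define the classical p-Laplacian of a differentiable function w : ℝ^N → ℝ at x by Δ_p w(x) := div(‖∇w‖^{p-2}·∇w)(x), where the divergence is the trace of the Fréchet derivative at x of the vector field y ↦ ‖∇w(y)‖^{p-2}·∇w(y). Assume that for every x ∈ Ω: −Δ_p u₁(x) = λ₁·ω(x)·u₁(x)^{p-1}, 0 ≤ u₁(x) ≤ 1, and ‖∇u₁(x)‖ ≤ G₁. Let f : ℝ^N × ℝ × ℝ^N → ℝ satisfy f(x, u, v) ≥ λ₁·ω(x)·u^{p-1} for all x ∈ Ω, u ∈ [0, ε₀] and v with ‖v‖ ≤ μ·M. Then for every ε with 0 < ε ≤ min(ε₀, μ·M/G₁), the function u_ε := ε·u₁ satisfies −Δ_p u_ε(x) ≤ f(x, u_ε(x), ∇u_ε(x)) for every x ∈ Ω. -/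
open Set

/-- The gradient is homogeneous of degree one. -/
theorem gradient_const_mul {F : Type*} [NormedAddCommGroup F] [InnerProductSpace ℝ F]
    [CompleteSpace F] (c : ℝ) (w : F → ℝ) (x : F) :
    gradient (fun y => c * w y) x = c • gradient w x := by
  have h : fderiv ℝ (fun y => c * w y) x = c • fderiv ℝ w x :=
    congrFun (fderiv_const_smul_field (𝕜 := ℝ) (f := w) c) x
  simp [gradient, h]

/-- Proposition 2 of the paper (pointwise, classical version): small multiples
`ε·u₁` of the first eigenfunction are sub-solutions of `−Δ_p u = f(x, u, ∇u)`. -/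
theorem stmt_10 (N : ℕ) (hN : 1 ≤ N) (Ω : Set (EuclideanSpace ℝ (Fin N)))
    (hΩ : IsOpen Ω) (p : ℝ) (hp : 1 < p)
    (u₁ : EuclideanSpace ℝ (Fin N) → ℝ) (hu₁ : Differentiable ℝ u₁)
    (ω : EuclideanSpace ℝ (Fin N) → ℝ) (lam1 G₁ eps0 mu M : ℝ)
    (hlam1 : 0 < lam1) (hG₁ : 0 < G₁) (heps0 : 0 < eps0)
    (hmu : 0 < mu) (hM : 0 < M)
    (heig : ∀ x ∈ Ω, -pLaplacian p u₁ x = lam1 * ω x * u₁ x ^ (p - 1))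
    (hu₁0 : ∀ x ∈ Ω, 0 ≤ u₁ x) (hu₁1 : ∀ x ∈ Ω, u₁ x ≤ 1)
    (hu₁G : ∀ x ∈ Ω, ‖gradient u₁ x‖ ≤ G₁)
    (f : EuclideanSpace ℝ (Fin N) × ℝ × EuclideanSpace ℝ (Fin N) → ℝ)
    (hf : ∀ x ∈ Ω, ∀ u ∈ Set.Icc (0:ℝ) eps0, ∀ v : EuclideanSpace ℝ (Fin N),
      ‖v‖ ≤ mu * M → f (x, u, v) ≥ lam1 * ω x * u ^ (p - 1)) :
    ∀ eps : ℝ, 0 < eps → eps ≤ min eps0 (mu * M / G₁) →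
      ∀ x ∈ Ω,
        -pLaplacian p (fun y => eps * u₁ y) x ≤
          f (x, eps * u₁ x, gradient (fun y => eps * u₁ y) x) := by
  intro eps heps hle x hx
  obtain ⟨hle0, hleG⟩ := le_min_iff.mp hle
  have hmem : eps * u₁ x ∈ Set.Icc (0 : ℝ) eps0 :=
    ⟨mul_nonneg heps.le (hu₁0 x hx),
      (mul_le_of_le_one_right heps.le (hu₁1 x hx)).trans hle0⟩
  have hgrad : ‖gradient (fun y => eps * u₁ y) x‖ ≤ mu * M := by
    rw [gradient_const_mul, norm_smul, Real.norm_of_nonneg heps.le]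
    exact (mul_le_mul_of_nonneg_left (hu₁G x hx) heps.le).trans ((le_div_iff₀ hG₁).mp hleG)
  calc -pLaplacian p (fun y => eps * u₁ y) x
      = eps ^ (p - 1) * -pLaplacian p u₁ x := by rw [pLaplacian_const_mul p heps, mul_neg]
    _ = lam1 * ω x * (eps * u₁ x) ^ (p - 1) := by
      rw [heig x hx, Real.mul_rpow heps.le (hu₁0 x hx)]
      ring
    _ ≤ f (x, eps * u₁ x, gradient (fun y => eps * u₁ y) x) := hf x hx _ hmem _ hgrad
end

section
/- Let α, μ, p, q be real numbers with α > 0, μ > 0 and 1 < q < p, and set λ_* = α·μ^{q-p}·(p/q − 1)^{(p-q)/p}·(q/p). Then for every real λ with 0 < λ ≤ λ_*, there exists M > 0 such that λ·M^{q-1}·(1 + μ^p·M^p) ≤ α·M^{p-1}. -/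
/-- Key algebraic step of Example 1 of the paper: with
`λ_* = α μ^(q-p) (p/q − 1)^((p-q)/p) (q/p)`, for every `0 < λ ≤ λ_*` there is
`M > 0` with `λ M^(q-1) (1 + μ^p M^p) ≤ α M^(p-1)`. -/
theorem stmt_14 (alpha mu p q : ℝ) (halpha : 0 < alpha) (hmu : 0 < mu)
    (hq : 1 < q) (hqp : q < p) :
    ∀ lam : ℝ, 0 < lam →
      lam ≤ alpha * mu ^ (q - p) * (p / q - 1) ^ ((p - q) / p) * (q / p) →
      ∃ M : ℝ, 0 < M ∧
        lam * M ^ (q - 1) * (1 + mu ^ p * M ^ p) ≤ alpha * M ^ (p - 1) := by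
  intro lam _ hle
  have hp : 0 < p := by linarith
  have hq0 : 0 < q := by linarith
  have hc : 0 < p / q - 1 := by
    rw [sub_pos, one_lt_div hq0]
    exact hqp
  set c := p / q - 1 with hc_def
  -- The maximiser of `M ^ (p - q) / (1 + mu ^ p * M ^ p)` satisfies `(mu * M) ^ p = c`.
  obtain ⟨M, hM_def⟩ : ∃ M : ℝ, M = c ^ (1 / p) * mu⁻¹ := ⟨_, rfl⟩
  have hM : 0 < M := by rw [hM_def]; positivity
  have hmuM : mu ^ p * M ^ p = c := by
    rw [← Real.mul_rpow hmu.le hM.le, hM_def, mul_left_comm, mul_inv_cancel₀ hmu.ne', mul_one,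
      ← Real.rpow_mul hc.le, one_div_mul_cancel hp.ne', Real.rpow_one]
  have hpow : M ^ (p - q) = mu ^ (q - p) * c ^ ((p - q) / p) := by
    rw [hM_def, Real.mul_rpow (by positivity) (by positivity), ← Real.rpow_mul hc.le,
      Real.inv_rpow hmu.le, ← Real.rpow_neg hmu.le, neg_sub, one_div_mul_eq_div, mul_comm]
  have hsplit : M ^ (p - 1) = M ^ (q - 1) * M ^ (p - q) := by
    rw [← Real.rpow_add hM]
    congr 1
    ring
  refine ⟨M, hM, ?_⟩
  calc lam * M ^ (q - 1) * (1 + mu ^ p * M ^ p)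
      = lam * (M ^ (q - 1) * (p / q)) := by rw [hmuM, hc_def]; ring
    _ ≤ alpha * mu ^ (q - p) * c ^ ((p - q) / p) * (q / p) * (M ^ (q - 1) * (p / q)) := by
        gcongr
    _ = alpha * M ^ (p - 1) := by
        rw [hsplit, hpow]
        field_simp
end
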